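/- arXiv:2209.10264 — 2 statements merged into one kernel-verified Lean document; each statement's English description precedes it below -/
import Mathlib

section
/- Let B be a finite connected simple graph containing distinct vertices x, x_1, y such that x has degree 1 with unique neighbor x_1, y ≠ x_1, and r_B(y, x_1) < 1 (which holds in particular when y is adjacent to x_1 and the edge yx_1 lies on a cycle of B). Then r_B(y) < r_B(x), i.e., the sum of resistance distances from y to all other vertices of B is strictly smaller than the sum of resistance distances from x to all other vertices of B. -/
/-!  Common definitions: Moore–Penrose pseudoinverse, resistance distance and
Kirchhoff index of a simple graph (unit resistors), weighted electrical networks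
(given by a symmetric conductance function), multigraph electrical networks,
and the octagonal chains `O(w)`.  -/

/-- `M` is a Moore–Penrose pseudoinverse of `A`. -/
def Matrix.IsMoorePenroseInv {n : Type} [Fintype n] (A M : Matrix n n ℝ) : Prop :=
  A * M * A = A ∧ M * A * M = M ∧ (A * M).transpose = A * M ∧ (M * A).transpose = M * A

open Classical in
/-- The Moore–Penrose pseudoinverse of a real square matrix (it exists and is
unique; defined by choice). -/
noncomputable def mpinv {n : Type} [Fintype n] (A : Matrix n n ℝ) : Matrix n n ℝ :=
  if h : ∃ M, A.IsMoorePenroseInv M then h.choose else 0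

open Classical in
/-- The (real) Laplacian matrix of a simple graph: degree diagonal minus adjacency. -/
noncomputable def glap {V : Type} [Fintype V] (G : SimpleGraph V) : Matrix V V ℝ :=
  fun u v =>
    if u = v then ((Finset.univ.filter (fun t => G.Adj u t)).card : ℝ)
    else if G.Adj u v then -1 else 0

/-- Resistance distance `r_G(u,v) = (e_u - e_v)ᵀ L⁺ (e_u - e_v)` in a simple graph,
each edge being a unit resistor. -/
noncomputable def resDist {V : Type} [Fintype V] (G : SimpleGraph V) (u v : V) : ℝ :=
  mpinv (glap G) u u - mpinv (glap G) u v - mpinv (glap G) v u + mpinv (glap G) v v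

/-- `r_G(a)`: the sum of the resistance distances between `a` and all other vertices. -/
noncomputable def resSum {V : Type} [Fintype V] [DecidableEq V] (G : SimpleGraph V) (a : V) : ℝ :=
  ∑ b ∈ Finset.univ.erase a, resDist G a b

/-- The Kirchhoff index: the sum of resistance distances over all unordered pairs. -/
noncomputable def kirchhoff {V : Type} [Fintype V] (G : SimpleGraph V) : ℝ :=
  (∑ u, ∑ v, resDist G u v) / 2

/-- A weighted graph (electrical network) on `V`, recorded by its symmetric
conductance function: `cond u v` is the reciprocal of the resistance of the edge
`uv` (and `0` if there is no such edge). -/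
structure Network (V : Type) where
  cond : V → V → ℝ
  symm : ∀ u v, cond u v = cond v u
  nonneg : ∀ u v, 0 ≤ cond u v
  loopless : ∀ v, cond v v = 0

/-- The weighted Laplacian of a network. -/
noncomputable def Network.lap {V : Type} [Fintype V] [DecidableEq V] (N : Network V) :
    Matrix V V ℝ :=
  fun u v => if u = v then ∑ t, N.cond u t else -N.cond u v

/-- Effective resistance in a network, via the pseudoinverse of the weighted Laplacian. -/
noncomputable def Network.effRes {V : Type} [Fintype V] [DecidableEq V] (N : Network V)
    (u v : V) : ℝ :=
  mpinv N.lap u u - mpinv N.lap u v - mpinv N.lap v u + mpinv N.lap v v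

/-- The underlying simple graph of a network. -/
def Network.toGraph {V : Type} (N : Network V) : SimpleGraph V :=
  SimpleGraph.fromRel (fun u v => N.cond u v ≠ 0)

/-- An electrical network with multiple edges allowed: a finite edge type, each edge a
non-loop with two endpoints and a positive resistance. -/
structure MultiNetwork (V : Type) where
  E : Type
  [fE : Fintype E]
  ends : E → Sym2 V
  not_loop : ∀ e, ¬ (ends e).IsDiag
  res : E → ℝ
  res_pos : ∀ e, 0 < res e

attribute [instance] MultiNetwork.fE

/-- Total conductance between `u` and `v`: the sum, over all edges joining `u` and `v`,
of the reciprocals of their resistances. -/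
noncomputable def MultiNetwork.cond {V : Type} [DecidableEq V] (M : MultiNetwork V)
    (u v : V) : ℝ :=
  ∑ e ∈ Finset.univ.filter (fun e => M.ends e = s(u, v)), (M.res e)⁻¹

/-- The weighted Laplacian of a multigraph network. -/
noncomputable def MultiNetwork.lap {V : Type} [Fintype V] [DecidableEq V]
    (M : MultiNetwork V) : Matrix V V ℝ :=
  fun u v => if u = v then ∑ t, M.cond u t else -M.cond u v

/-- Effective resistance in a multigraph network. -/
noncomputable def MultiNetwork.effRes {V : Type} [Fintype V] [DecidableEq V]
    (M : MultiNetwork V) (u v : V) : ℝ :=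
  mpinv M.lap u u - mpinv M.lap u v - mpinv M.lap v u + mpinv M.lap v v

/-- The underlying simple graph of a multigraph network. -/
def MultiNetwork.toGraph {V : Type} (M : MultiNetwork V) : SimpleGraph V :=
  SimpleGraph.fromRel (fun u v => ∃ e, M.ends e = s(u, v))

/-!  The octagonal chain `O(w)` with `n` octagons, `w = (w_1, …, w_{n-2})`,
`w_i ∈ {0,1,2,3,4}`.  Its `6n+2` vertices are laid out along the outer boundary
cycle `0, 1, …, 6n+1`: position `0` is the top-left corner, the top boundary runs
rightwards (the top of the octagon `H_i`, `1 ≤ i ≤ n-2`, carries `w_i` inserted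
vertices), then the right vertical edge, then the bottom boundary runs leftwards
back to the bottom-left corner `6n+1`.  The graph is this outer cycle together
with the `n-1` chords `t_k b_k` shared by consecutive octagons. -/

/-- Boundary position of the top vertex `t_k` (`1 ≤ k ≤ n-1`) of the `k`-th shared
vertical edge: `t_k = k + w_1 + ⋯ + w_{k-1}`. -/
def tpos (n : ℕ) (w : Fin (n - 2) → Fin 5) (k : ℕ) : ℕ :=
  k + ∑ j ∈ Finset.univ.filter (fun j : Fin (n - 2) => (j : ℕ) + 1 < k), ((w j : ℕ))

/-- Boundary position of the bottom vertex `b_k` (`1 ≤ k ≤ n-1`) of the `k`-th shared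
vertical edge: `b_k = n + (w_1 + ⋯ + w_{n-2}) + 6 + Σ_{j ≥ k} (5 - w_j)`. -/
def bpos (n : ℕ) (w : Fin (n - 2) → Fin 5) (k : ℕ) : ℕ :=
  n + (∑ j, ((w j : ℕ))) + 6 +
    ∑ j ∈ Finset.univ.filter (fun j : Fin (n - 2) => k ≤ (j : ℕ) + 1), (5 - ((w j : ℕ)))

/-- The octagonal chain `O(w)` with `n` octagons: the outer boundary cycle on
`6n+2` vertices together with the chords `t_k b_k`, `k = 1, …, n-1`. -/
def octChain (n : ℕ) (w : Fin (n - 2) → Fin 5) : SimpleGraph (Fin (6 * n + 2)) :=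
  SimpleGraph.fromRel (fun a b =>
    ((a : ℕ) + 1 = (b : ℕ)) ∨ ((a : ℕ) = 6 * n + 1 ∧ (b : ℕ) = 0) ∨
    ∃ k, 1 ≤ k ∧ k ≤ n - 1 ∧ (a : ℕ) = tpos n w k ∧ (b : ℕ) = bpos n w k)


section aux
open Classical

theorem glap_eq {V : Type} [Fintype V] (G : SimpleGraph V) : glap G = G.lapMatrix ℝ := by
  ext u v
  by_cases h : u = v
  · subst h
    simp [glap, SimpleGraph.lapMatrix, SimpleGraph.degMatrix, SimpleGraph.degree,
      SimpleGraph.neighborFinset_eq_filter]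
  · simp [glap, SimpleGraph.lapMatrix, SimpleGraph.degMatrix, h, SimpleGraph.adjMatrix_apply]
    split_ifs <;> simp

theorem glap_mulVec {V : Type} [Fintype V] (G : SimpleGraph V) (p : V → ℝ) (v : V) :
    (glap G).mulVec p v = ∑ u, if G.Adj v u then p v - p u else 0 := by
  rw [glap_eq, SimpleGraph.lapMatrix_mulVec_apply]
  rw [← Finset.sum_filter, ← SimpleGraph.neighborFinset_eq_filter, Finset.sum_sub_distrib]
  simp

theorem glap_symm {V : Type} [Fintype V] (G : SimpleGraph V) : (glap G).transpose = glap G := by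
  rw [glap_eq]; exact G.isSymm_lapMatrix (R := ℝ)

/-- averaging matrix -/
noncomputable def avgM (V : Type) [Fintype V] : Matrix V V ℝ :=
  fun _ _ => (Fintype.card V : ℝ)⁻¹

theorem avg_symm (V : Type) [Fintype V] : (avgM V).transpose = avgM V := rfl

theorem glap_avg {V : Type} [Fintype V] (G : SimpleGraph V) : glap G * avgM V = 0 := by
  ext u v
  have := glap_mulVec G (fun _ => (Fintype.card V : ℝ)⁻¹) u
  simp at this
  simpa [Matrix.mul_apply, avgM, Matrix.mulVec, dotProduct] using this

theorem avg_glap {V : Type} [Fintype V] (G : SimpleGraph V) : avgM V * glap G = 0 := by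
  have := congrArg Matrix.transpose (glap_avg G)
  simpa [Matrix.transpose_mul, glap_symm, avg_symm] using this

theorem avg_sq {V : Type} [Fintype V] [Nonempty V] : avgM V * avgM V = avgM V := by
  ext u v
  simp [Matrix.mul_apply, avgM]

theorem glap_ker {V : Type} [Fintype V] (G : SimpleGraph V) (hG : G.Connected) (p : V → ℝ)
    (h : (glap G).mulVec p = 0) (u v : V) : p u = p v := by
  rw [glap_eq] at h
  exact (G.lapMatrix_mulVec_eq_zero_iff_forall_reachable.1 h) u v (hG.preconnected u v)

theorem mp_exists {V : Type} [Fintype V] (G : SimpleGraph V) (hG : G.Connected) :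
    ∃ M, (glap G).IsMoorePenroseInv M := by
  haveI := hG.nonempty
  have hinj : Function.Injective (glap G + avgM V).mulVec := by
    have : Function.Injective (Matrix.mulVecLin (glap G + avgM V)) := by
      rw [injective_iff_map_eq_zero]
      intro p hp
      rw [Matrix.mulVecLin_apply] at hp
      have h1 : (avgM V).mulVec p = 0 := by
        have := congrArg (avgM V).mulVec hp
        rwa [Matrix.mulVec_mulVec, mul_add, avg_glap, avg_sq, zero_add, Matrix.mulVec_zero] at this
      have h2 : (glap G).mulVec p = 0 := by
        rwa [Matrix.add_mulVec, h1, add_zero] at hp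
      ext u
      have h3 := congrFun h1 u
      have hc := glap_ker G hG p h2
      simp only [Matrix.mulVec, dotProduct, avgM] at h3
      rw [Finset.sum_congr rfl (fun v _ => by rw [hc v u])] at h3
      simpa using h3
    exact this
  have hu : IsUnit (glap G + avgM V) := Matrix.mulVec_injective_iff_isUnit.1 hinj
  obtain ⟨N, hN1, hN2⟩ := isUnit_iff_exists.1 hu
  have e1 := glap_avg G
  have e2 := avg_glap G
  have e3 := avg_sq (V := V)
  have hs := avg_symm V
  generalize glap G = L at *
  generalize avgM V = K at *
  have hAK : (L + K) * K = K := by rw [add_mul, e1, e3, zero_add]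
  have hKA : K * (L + K) = K := by rw [mul_add, e2, e3, zero_add]
  have hNK : N * K = K := by
    calc N * K = N * ((L + K) * K) := by rw [hAK]
      _ = K := by rw [← mul_assoc, hN2, one_mul]
  have hKN : K * N = K := by
    calc K * N = (K * (L + K)) * N := by rw [hKA]
      _ = K := by rw [mul_assoc, hN1, mul_one]
  have hLN : L * N = 1 - K := by
    rw [eq_sub_iff_add_eq, ← hN1, add_mul, hKN]
  have hNL : N * L = 1 - K := by
    rw [eq_sub_iff_add_eq, ← hN2, mul_add, hNK]
  have hLM : L * (N - K) = 1 - K := by rw [mul_sub, e1, sub_zero, hLN]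
  have hML : (N - K) * L = 1 - K := by rw [sub_mul, e2, sub_zero, hNL]
  refine ⟨N - K, ?_, ?_, ?_, ?_⟩
  · rw [hLM, sub_mul, e2, one_mul, sub_zero]
  · rw [hML, sub_mul, one_mul, mul_sub, hKN, e3, sub_self, sub_zero]
  · rw [hLM, Matrix.transpose_sub, hs, Matrix.transpose_one]
  · rw [hML, Matrix.transpose_sub, hs, Matrix.transpose_one]

theorem proj_eq {V : Type} [Fintype V] (G : SimpleGraph V) (hG : G.Connected)
    (P : Matrix V V ℝ) (hs : P.transpose = P) (h1 : glap G * P = glap G)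
    (h0 : avgM V * P = 0) : P = 1 - avgM V := by
  haveI := hG.nonempty
  have hk : ∀ u u' v, (1 - P) u v = (1 - P) u' v := by
    intro u u' v
    refine glap_ker G hG (fun w => (1 - P) w v) ?_ u u'
    have : glap G * (1 - P) = 0 := by rw [mul_sub, h1, mul_one, sub_self]
    ext w
    exact congrFun (congrFun this w) v
  have h2 : avgM V * (1 - P) = 1 - P := by
    ext u v
    rw [Matrix.mul_apply, Finset.sum_congr rfl (fun w _ => by rw [hk w u v])]
    simp [avgM]
  rw [mul_sub, h0, mul_one, sub_zero] at h2
  rw [h2]; abel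

theorem mp_facts {V : Type} [Fintype V] (G : SimpleGraph V) (hG : G.Connected) :
    (mpinv (glap G)).transpose = mpinv (glap G) ∧ glap G * mpinv (glap G) = 1 - avgM V ∧
    mpinv (glap G) * avgM V = 0 := by
  have h : (glap G).IsMoorePenroseInv (mpinv (glap G)) := by
    unfold mpinv
    rw [dif_pos (mp_exists G hG)]
    exact (mp_exists G hG).choose_spec
  generalize mpinv (glap G) = M at *
  obtain ⟨a, b, c, d⟩ := h
  have c' : M.transpose * glap G = glap G * M := by
    rw [← c, Matrix.transpose_mul, glap_symm, ← c] at *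
  have d' : glap G * M.transpose = M * glap G := by
    rw [← d, Matrix.transpose_mul, glap_symm]
  have hP : glap G * M = 1 - avgM V := by
    apply proj_eq G hG _ c
    · rw [← c', ← mul_assoc, d', mul_assoc]
      have := congrArg Matrix.transpose a
      rw [Matrix.transpose_mul, Matrix.transpose_mul, glap_symm, ← mul_assoc, d'] at this
      rwa [← mul_assoc]
    · rw [← mul_assoc, avg_glap, zero_mul]
  have hQ : M * glap G = 1 - avgM V := by
    apply proj_eq G hG _ d
    · rw [← mul_assoc, a]
    · rw [← d', ← mul_assoc, avg_glap, zero_mul]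
  refine ⟨?_, hP, ?_⟩
  · have e : M = M.transpose * glap G * M := by rw [c', hP, ← hQ, b]
    conv_lhs => rw [e]
    conv_rhs => rw [e]
    simp [Matrix.transpose_mul, glap_symm, mul_assoc]
  · have : M * (glap G * M) = M := by rw [← mul_assoc, b]
    rw [hP, mul_sub, mul_one] at this
    simpa using this

end aux

theorem resSum_lt_pendant {V : Type} [Fintype V] [DecidableEq V] (B : SimpleGraph V)
    (hB : B.Connected) (x x₁ y : V) (hd : [x, x₁, y].Pairwise (· ≠ ·))
    (hx : ∀ t, B.Adj x t ↔ t = x₁)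
    (hres : resDist B y x₁ < 1) :
    resSum B y < resSum B x := by
  classical
  haveI := hB.nonempty
  obtain ⟨hs, hP, hK⟩ := mp_facts B hB
  have hsum : ∀ a, resSum B a = Fintype.card V * mpinv (glap B) a a
      + ∑ b, mpinv (glap B) b b := by
    intro a
    have hr : ∑ b, mpinv (glap B) a b = 0 := by
      have := congrFun (congrFun hK a) a
      simp only [Matrix.mul_apply, avgM, ← Finset.sum_mul] at this
      simpa using this
    have hc : ∑ b, mpinv (glap B) b a = 0 := by
      rw [← hr]
      exact Finset.sum_congr rfl fun b _ => congrFun (congrFun hs a) b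
    have : resSum B a = ∑ b, resDist B a b := by
      unfold resSum
      apply Finset.sum_erase
      simp [resDist]
    rw [this]
    simp only [resDist, Finset.sum_add_distrib, Finset.sum_sub_distrib, hr, hc]
    simp
  have hcol : ∀ v w, (∑ u, if B.Adj v u then mpinv (glap B) v w - mpinv (glap B) u w else 0)
      = (if v = w then 1 else 0) - (Fintype.card V : ℝ)⁻¹ := by
    intro v w
    rw [← glap_mulVec B (fun u => mpinv (glap B) u w) v]
    have := congrFun (congrFun hP v) w
    simp only [Matrix.sub_apply, Matrix.one_apply, avgM] at this
    refine Eq.trans ?_ (this.trans ?_)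
    · rfl
    · by_cases h : v = w <;> simp [h]
  have hrow : ∀ w, mpinv (glap B) x w - mpinv (glap B) x₁ w
      = (if x = w then 1 else 0) - (Fintype.card V : ℝ)⁻¹ := by
    intro w
    rw [← hcol x w]
    simp [hx]
  simp only [List.pairwise_cons, List.mem_cons, List.not_mem_nil, or_false] at hd
  have hxx1 : x ≠ x₁ := hd.1 _ (Or.inl rfl)
  have hyx1 : x₁ ≠ y := hd.2.1 _ rfl
  have hn : (0 : ℝ) < Fintype.card V := by exact_mod_cast Fintype.card_pos
  have hsy : ∀ u v, mpinv (glap B) u v = mpinv (glap B) v u :=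
    fun u v => congrFun (congrFun hs v) u
  have h1 := hrow x
  have h2 := hrow x₁
  rw [if_pos rfl] at h1
  rw [if_neg hxx1] at h2
  have h3 : mpinv (glap B) y x₁ + (Fintype.card V : ℝ)⁻¹ ≤ mpinv (glap B) x₁ x₁ := by
    obtain ⟨v, hv, hmax⟩ := Finset.exists_max_image (Finset.univ.erase x₁)
      (fun v => mpinv (glap B) v x₁) ⟨y, by simp [hyx1.symm]⟩
    have hvx : v ≠ x₁ := by simpa using hv
    have hvy := hmax y (by simp [hyx1.symm])
    have hc := hcol v x₁
    rw [if_neg hvx, ← Finset.add_sum_erase _ _ (Finset.mem_univ x₁)] at hc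
    have hnn : 0 ≤ ∑ u ∈ Finset.univ.erase x₁,
        if B.Adj v u then mpinv (glap B) v x₁ - mpinv (glap B) u x₁ else 0 := by
      apply Finset.sum_nonneg
      intro u hu
      have := hmax u hu
      split_ifs
      · simpa using this
      · exact le_rfl
    have hinv : (0 : ℝ) < (Fintype.card V : ℝ)⁻¹ := inv_pos.2 hn
    split_ifs at hc
    · linarith
    · linarith
  rw [hsum, hsum]
  have : mpinv (glap B) y y < mpinv (glap B) x x := by
    unfold resDist at hres
    have := hsy x x₁
    have := hsy y x₁
    linarith
  have := mul_lt_mul_of_pos_left this hn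
  linarith
end

section
/- Every octagonal chain with minimum Kirchhoff index among all octagonal chains with n octagons (n ≥ 3) is an all-kink chain: if O(w), w = (w_1,...,w_{n−2}), satisfies Kf(O(w)) ≤ Kf(O(w'')) for every vector w'' ∈ {0,1,2,3,4}^{n−2}, then w_i ∈ {0,4} for every i ∈ {1,...,n−2}. -/
namespace OctAux

open Matrix Finset

theorem exists_mp {V : Type} [Fintype V] (A : Matrix V V ℝ) (hA : A.IsHermitian) :
    ∃ M, A.IsMoorePenroseInv M := by
  classical
  obtain ⟨U, d, hU, hA'⟩ : ∃ (U : Matrix V V ℝ) (d : V → ℝ), Uᵀ * U = 1 ∧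
      A = U * diagonal d * Uᵀ := by
    refine ⟨hA.eigenvectorUnitary, hA.eigenvalues, ?_, ?_⟩
    · have := Unitary.coe_star_mul_self hA.eigenvectorUnitary
      simpa [Matrix.star_eq_conjTranspose] using this
    · have := hA.spectral_theorem
      simpa [Unitary.conjStarAlgAut_apply, Matrix.star_eq_conjTranspose] using this
  have key : ∀ a b : V → ℝ, (U * diagonal a * Uᵀ) * (U * diagonal b * Uᵀ) =
      U * diagonal (fun i => a i * b i) * Uᵀ := by
    intro a b
    calc _ = U * diagonal a * (Uᵀ * U) * diagonal b * Uᵀ := by simp only [Matrix.mul_assoc]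
      _ = _ := by rw [hU, Matrix.mul_one, Matrix.mul_assoc U, diagonal_mul_diagonal]
  have tr : ∀ a : V → ℝ, (U * diagonal a * Uᵀ)ᵀ = U * diagonal a * Uᵀ := by
    intro a
    simp [Matrix.transpose_mul, Matrix.mul_assoc]
  have h1 : ∀ i, d i * (d i)⁻¹ * d i = d i := fun i => mul_inv_mul_cancel _
  have h2 : ∀ i, (d i)⁻¹ * d i * (d i)⁻¹ = (d i)⁻¹ := fun i => by
    by_cases h : d i = 0 <;> simp [h]
  refine ⟨U * diagonal (fun i => (d i)⁻¹) * Uᵀ, ?_, ?_, ?_, ?_⟩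
  · rw [hA', key, key]; simp only [h1]
  · rw [hA', key, key]; simp only [h2]
  · rw [hA', key, tr]
  · rw [hA', key, tr]

theorem glap_symm {V : Type} [Fintype V] (G : SimpleGraph V) : (glap G).IsHermitian := by
  ext u v
  simp only [conjTranspose_apply, glap, star_trivial]
  by_cases h : u = v
  · subst h; rfl
  · rw [if_neg h, if_neg (Ne.symm h)]
    by_cases h' : G.Adj u v
    · rw [if_pos h', if_pos h'.symm]
    · rw [if_neg h', if_neg (fun h => h' h.symm)]

theorem resDist_eq {V : Type} [Fintype V] [DecidableEq V] (G : SimpleGraph V) (u v : V) (x : V → ℝ)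
    (hx : glap G *ᵥ x = Pi.single u 1 - Pi.single v 1) : resDist G u v = x u - x v := by
  have hex := exists_mp _ (glap_symm G)
  have hM : (glap G).IsMoorePenroseInv (mpinv (glap G)) := by
    rw [mpinv, dif_pos hex]; exact hex.choose_spec
  have hs : (glap G)ᵀ = glap G := by
    have := glap_symm G
    rwa [Matrix.IsHermitian, conjTranspose_eq_transpose_of_trivial] at this
  have e1 : resDist G u v = (Pi.single u 1 - Pi.single v 1) ⬝ᵥ
      (mpinv (glap G) *ᵥ (Pi.single u 1 - Pi.single v 1)) := by
    simp [resDist, Matrix.mulVec_sub, sub_dotProduct]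
    ring
  rw [e1, ← hx, Matrix.mulVec_mulVec]
  nth_rewrite 1 [← hs]
  rw [Matrix.mulVec_transpose, ← Matrix.dotProduct_mulVec, Matrix.mulVec_mulVec, ← Matrix.mul_assoc,
    hM.1, hx]
  simp [dotProduct_sub]

/-- extension by zero -/
def ext {n : ℕ} (x : Fin n → ℝ) (k : ℕ) : ℝ := if h : k < n then x ⟨k, h⟩ else 0

theorem ext_fin {n : ℕ} (x : Fin n → ℝ) (k : Fin n) : ext x k = x k := by simp [ext]

theorem sum_ite_ext {n : ℕ} (x : Fin n → ℝ) (m : ℕ) :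
    ∑ k : Fin n, (if m = (k : ℕ) then x k else 0) = ext x m := by
  unfold ext
  split_ifs with h
  · rw [Finset.sum_eq_single ⟨m, h⟩]
    · simp
    · intro b _ hb
      rw [if_neg]; intro e; apply hb; ext; simp [e]
    · simp
  · apply Finset.sum_eq_zero
    intro k _
    rw [if_neg]; have := k.2; omega

/-- previous value -/
def prv {n : ℕ} (x : Fin n → ℝ) (k : ℕ) : ℝ := if k = 0 then 0 else ext x (k - 1)

/-- the dual Gram matrix -/
def MM (n : ℕ) : Matrix (Fin n) (Fin n) ℝ := fun j k =>
  (if (j : ℕ) = k then 8 else 0) - (if (j : ℕ) + 1 = k then 1 else 0)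
    - (if (k : ℕ) + 1 = j then 1 else 0)

theorem MM_symm (n : ℕ) : (MM n)ᵀ = MM n := by
  ext j k
  simp only [MM, transpose_apply, eq_comm (a := (k : ℕ)) (b := (j : ℕ))]
  ring

theorem MM_mulVec {n : ℕ} (x : Fin n → ℝ) (j : Fin n) :
    (MM n *ᵥ x) j = 8 * x j - ext x (j + 1) - prv x j := by
  have h3 : ∑ k : Fin n, (if (k : ℕ) + 1 = j then x k else 0) = prv x j := by
    unfold prv
    split_ifs with h
    · apply Finset.sum_eq_zero; intro k _; rw [if_neg]; omega
    · rw [← sum_ite_ext]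
      apply Finset.sum_congr rfl; intro k _
      congr 1
      apply propext; omega
  rw [← h3, ← sum_ite_ext, ← ext_fin x j, ← sum_ite_ext, Finset.mul_sum, ← Finset.sum_sub_distrib,
    ← Finset.sum_sub_distrib]
  change ∑ k, MM n j k * x k = _
  apply Finset.sum_congr rfl
  intro k _
  simp only [MM, sub_mul, ite_mul, mul_ite, mul_zero, zero_mul, one_mul]

theorem MM_max {n : ℕ} (x : Fin n → ℝ) (h : ∀ j, 0 ≤ (MM n *ᵥ x) j) : ∀ j, 0 ≤ x j := by
  intro j0
  have : Nonempty (Fin n) := ⟨j0⟩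
  obtain ⟨j, hj⟩ := Finite.exists_min x
  have hj' : 0 ≤ x j := by
    by_contra hneg
    push Not at hneg
    have e : ∀ k, x j ≤ ext x k := by
      intro k; unfold ext; split_ifs
      · exact hj _
      · exact hneg.le
    have e2 : x j ≤ prv x j := by
      unfold prv; split_ifs
      · exact hneg.le
      · exact e _
    have := h j
    rw [MM_mulVec] at this
    linarith [e (j + 1)]
  exact hj'.trans (hj j0)

theorem MM_unit (n : ℕ) : IsUnit (MM n) := by
  rw [← Matrix.mulVec_injective_iff_isUnit]
  intro x y hxy
  have h1 : MM n *ᵥ (x - y) = 0 := by rw [Matrix.mulVec_sub]; exact sub_eq_zero.2 hxy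
  have h2 : MM n *ᵥ (y - x) = 0 := by rw [Matrix.mulVec_sub]; exact sub_eq_zero.2 hxy.symm
  ext j
  have a := MM_max (x - y) (by simp [h1]) j
  have b := MM_max (y - x) (by simp [h2]) j
  simp at a b
  linarith

theorem MM_sol {n : ℕ} (c : Fin n → ℝ) : MM n *ᵥ ((MM n)⁻¹ *ᵥ c) = c := by
  rw [Matrix.mulVec_mulVec, Matrix.mul_nonsing_inv _ ((Matrix.isUnit_iff_isUnit_det _).1 (MM_unit n)),
    Matrix.one_mulVec]

/-- the energy form -/
noncomputable def BB (n : ℕ) : LinearMap.BilinForm ℝ (Fin n → ℝ) := Matrix.toBilin' ((MM n)⁻¹)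

theorem BB_apply {n : ℕ} (c d : Fin n → ℝ) : BB n c d = c ⬝ᵥ ((MM n)⁻¹ *ᵥ d) := by
  rw [BB, Matrix.toBilin'_apply']

theorem BB_symm {n : ℕ} (c d : Fin n → ℝ) : BB n c d = BB n d c := by
  rw [BB_apply, BB_apply, Matrix.dotProduct_mulVec, dotProduct_comm, ← Matrix.mulVec_transpose,
    Matrix.transpose_nonsing_inv, MM_symm]

theorem ext_nonneg {n : ℕ} (x : Fin n → ℝ) (h : ∀ j, 0 ≤ x j) (k : ℕ) : 0 ≤ ext x k := by
  unfold ext; split_ifs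
  · exact h _
  · exact le_rfl

theorem prv_nonneg {n : ℕ} (x : Fin n → ℝ) (h : ∀ j, 0 ≤ x j) (k : ℕ) : 0 ≤ prv x k := by
  unfold prv; split_ifs
  · exact le_rfl
  · exact ext_nonneg _ h _

theorem ext_le {n : ℕ} (x : Fin n → ℝ) (h : ∀ j, x j ≤ 1) (k : ℕ) : ext x k ≤ 1 := by
  unfold ext; split_ifs
  · exact h _
  · exact zero_le_one

theorem prv_le {n : ℕ} (x : Fin n → ℝ) (h : ∀ j, x j ≤ 1) (k : ℕ) : prv x k ≤ 1 := by
  unfold prv; split_ifs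
  · exact zero_le_one
  · exact ext_le _ h _

/-- The key inequality. -/
theorem key_ineq {n : ℕ} (i : Fin n) (W : Fin n → ℝ) (b c : ℝ) (hb : 7 ≤ b) (hc : 13 ≤ c)
    (hW0 : ∀ j, 0 ≤ W j) (hWi : W i = 0) (hWs : ∑ j, W j = b) (hW1 : ∀ j, W j ≤ 6 +
      (if (j : ℕ) = 0 then 1 else 0) + (if (j : ℕ) + 1 = n then 1 else 0)) :
    0 < (b + c) * BB n (b • Pi.single i 1 - W) (Pi.single i 1)
      - BB n (b • Pi.single i 1 - W) (b • Pi.single i 1 - W) := by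
  set e : Fin n → ℝ := Pi.single i 1 with he
  set g := (MM n)⁻¹ *ᵥ W with hg
  set p := (MM n)⁻¹ *ᵥ e with hp
  have Mg : MM n *ᵥ g = W := MM_sol W
  have Mp : MM n *ᵥ p = e := MM_sol e
  have g0 : ∀ j, 0 ≤ g j := MM_max g (by rw [Mg]; exact hW0)
  have p0 : ∀ j, 0 ≤ p j := MM_max p (by
    rw [Mp]; intro j; rw [he, Pi.single_apply]; split_ifs <;> norm_num)
  have g1 : ∀ j, g j ≤ 1 := by
    have := MM_max ((fun _ => 1) - g) (by
      intro j
      rw [Matrix.mulVec_sub, Mg, Pi.sub_apply, MM_mulVec]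
      have h1 := hW1 j
      have h2 : ext (fun _ : Fin n => (1 : ℝ)) (j + 1) = if (j : ℕ) + 1 = n then 0 else 1 := by
        unfold ext; have := j.2
        split_ifs <;> first | rfl | omega
      have h3 : prv (fun _ : Fin n => (1 : ℝ)) j = if (j : ℕ) = 0 then 0 else 1 := by
        unfold prv ext; have := j.2
        split_ifs <;> first | rfl | omega
      rw [h2, h3]
      split_ifs at h1 ⊢ <;> linarith)
    intro j
    have := this j
    simp at this
    linarith
  have hgi : g i ≤ 1 / 4 := by
    have := congrFun Mg i
    rw [MM_mulVec, hWi] at this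
    linarith [ext_le g g1 (i + 1), prv_le g g1 i]
  have hpi : 1 / 8 ≤ p i := by
    have := congrFun Mp i
    rw [MM_mulVec, he, Pi.single_eq_same] at this
    linarith [ext_nonneg p p0 (i + 1), prv_nonneg p p0 i]
  have Bee : BB n e e = p i := by
    rw [BB_apply, ← hp, he, single_one_dotProduct]
  have BeW : BB n e W = g i := by
    rw [BB_apply, ← hg, he, single_one_dotProduct]
  have BWe : BB n W e = g i := by rw [BB_symm, BeW]
  have BWW : BB n W W ≤ b := by
    rw [BB_apply, ← hg, ← hWs]
    apply Finset.sum_le_sum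
    intro j _
    have := mul_le_mul_of_nonneg_left (g1 j) (hW0 j)
    linarith
  simp only [map_sub, map_smul, LinearMap.sub_apply, LinearMap.smul_apply, smul_eq_mul, Bee, BeW, BWe]
  have gi0 := g0 i
  nlinarith [mul_nonneg (by linarith : (0:ℝ) ≤ b) gi0, mul_nonneg (by linarith : (0:ℝ) ≤ c) (sub_nonneg.2 hgi),
    mul_nonneg (mul_nonneg (by linarith : (0:ℝ) ≤ b) (by linarith : (0:ℝ) ≤ c)) (sub_nonneg.2 hpi),
    mul_nonneg (sub_nonneg.2 hb) (sub_nonneg.2 hc)]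

/-- quadratic spread -/
def QQ {V : Type} [AddCommGroup V] [Module ℝ V] (B : LinearMap.BilinForm ℝ V) (N : ℕ) (s : ℕ → V) : ℝ :=
  ∑ u ∈ range N, ∑ v ∈ range N, B (s v - s u) (s v - s u)

theorem QQ_eq {V : Type} [AddCommGroup V] [Module ℝ V] (B : LinearMap.BilinForm ℝ V)
    (N : ℕ) (s : ℕ → V) :
    QQ B N s = 2 * (N * ∑ v ∈ range N, B (s v) (s v)) -
      2 * B (∑ v ∈ range N, s v) (∑ v ∈ range N, s v) := by
  have h : B (∑ v ∈ range N, s v) (∑ v ∈ range N, s v) =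
      ∑ u ∈ range N, ∑ v ∈ range N, B (s u) (s v) := by
    simp [map_sum, LinearMap.sum_apply]
    exact Finset.sum_comm
  have h' : B (∑ v ∈ range N, s v) (∑ v ∈ range N, s v) =
      ∑ u ∈ range N, ∑ v ∈ range N, B (s v) (s u) := by
    rw [h, Finset.sum_comm]
  unfold QQ
  simp only [map_sub, LinearMap.sub_apply, Finset.sum_sub_distrib]
  rw [← h, ← h']
  simp only [Finset.sum_const, card_range, nsmul_eq_mul, ← Finset.mul_sum]
  ring

theorem shift_sum {V A : Type} [AddCommGroup V] [AddCommGroup A] (φ : V → A) (N τ β : ℕ) (s s1 : ℕ → V) (e : V)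
    (hτ : τ ≤ β) (hβ : β + 1 < N) (h1 : ∀ v ≤ τ, s1 v = s v)
    (h2 : ∀ v, τ ≤ v → v ≤ β → s1 (v + 1) = s v + e) (h3 : ∀ v, β < v → s1 v = s v) :
    ∑ v ∈ range N, φ (s1 v) = ∑ v ∈ range N, φ (s v) +
      (∑ v ∈ Ico τ β, (φ (s v + e) - φ (s v)) + φ (s τ) - φ (s β)) := by
  have split : ∀ f : ℕ → A, ∑ v ∈ range N, f v = ∑ v ∈ range (τ + 1), f v +
      ∑ v ∈ Ico (τ + 1) (β + 1), f v + ∑ v ∈ Ico (β + 1) N, f v := by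
    intro f
    rw [Finset.sum_range_add_sum_Ico _ (by omega), Finset.sum_range_add_sum_Ico _ (by omega)]
  rw [split, split]
  have a1 : ∑ v ∈ range (τ + 1), φ (s1 v) = ∑ v ∈ range (τ + 1), φ (s v) :=
    Finset.sum_congr rfl fun v hv => by rw [h1 v (by simp at hv; omega)]
  have a3 : ∑ v ∈ Ico (β + 1) N, φ (s1 v) = ∑ v ∈ Ico (β + 1) N, φ (s v) :=
    Finset.sum_congr rfl fun v hv => by rw [h3 v (by simp at hv; omega)]
  have a2 : ∑ v ∈ Ico (τ + 1) (β + 1), φ (s1 v) = ∑ v ∈ Ico τ β, φ (s v + e) := by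
    rw [← Finset.sum_Ico_add' (fun v => φ (s1 v)) τ β 1]
    exact Finset.sum_congr rfl fun v hv => by
      simp at hv; rw [h2 v (by omega) (by omega)]
  have a4 : ∑ v ∈ Ico τ β, φ (s v) + φ (s β) = φ (s τ) + ∑ v ∈ Ico (τ + 1) (β + 1), φ (s v) := by
    rw [← Finset.sum_Ico_succ_top hτ, Finset.sum_eq_sum_Ico_succ_bot (by omega)]
  rw [a1, a2, a3, Finset.sum_sub_distrib]
  have : ∑ v ∈ Ico (τ + 1) (β + 1), φ (s v) = ∑ v ∈ Ico τ β, φ (s v) + φ (s β) - φ (s τ) := by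
    rw [a4]; abel
  rw [this]; abel

theorem second_diff {V : Type} [AddCommGroup V] [Module ℝ V] (B : LinearMap.BilinForm ℝ V)
    (hB : ∀ x y, B x y = B y x) (N τ β : ℕ) (s s1 s2 : ℕ → V) (e : V)
    (hτ : τ ≤ β) (hβ : β + 2 < N) (h1 : ∀ v ≤ τ, s1 v = s v)
    (h2 : ∀ v, τ ≤ v → v ≤ β → s1 (v + 1) = s v + e) (h3 : ∀ v, β < v → s1 v = s v)
    (k1 : ∀ v ≤ τ + 1, s2 v = s1 v)
    (k2 : ∀ v, τ + 1 ≤ v → v ≤ β + 1 → s2 (v + 1) = s1 v + e) (k3 : ∀ v, β + 1 < v → s2 v = s1 v) :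
    QQ B N s2 + QQ B N s - 2 * QQ B N s1 =
      4 * (N * B (((β - τ : ℕ) : ℝ) • e - (s β - s τ)) e
       - B (((β - τ : ℕ) : ℝ) • e - (s β - s τ)) (((β - τ : ℕ) : ℝ) • e - (s β - s τ))) := by
  have D1 := fun (A : Type) (_ : AddCommGroup A) (φ : V → A) =>
    shift_sum φ N τ β s s1 e hτ (by omega) h1 h2 h3
  have D2 : ∀ (A : Type) (_ : AddCommGroup A) (φ : V → A), ∑ v ∈ range N, φ (s2 v) =
      ∑ v ∈ range N, φ (s1 v) +
      (∑ v ∈ Ico τ β, (φ (s v + e + e) - φ (s v + e)) + φ (s τ + e) - φ (s β + e)) := by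
    intro A _ φ
    rw [shift_sum φ N (τ + 1) (β + 1) s1 s2 e (by omega) (by omega) k1 k2 k3,
      ← Finset.sum_Ico_add' _ τ β 1, h2 τ le_rfl hτ, h2 β hτ le_rfl]
    have : ∑ v ∈ Ico τ β, (φ (s1 (v + 1) + e) - φ (s1 (v + 1))) =
        ∑ v ∈ Ico τ β, (φ (s v + e + e) - φ (s v + e)) :=
      Finset.sum_congr rfl fun v hv => by
        simp at hv; rw [h2 v (by omega) (by omega)]
    rw [this]
  have L1 := D1 V inferInstance id
  have L2 := D2 V inferInstance id
  have q1 := D1 ℝ inferInstance (fun x => B x x)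
  have q2 := D2 ℝ inferInstance (fun x => B x x)
  simp only [id, add_sub_cancel_left, Finset.sum_const, Nat.card_Ico, ← Nat.cast_smul_eq_nsmul ℝ] at L1 L2
  set b : ℝ := ((β - τ : ℕ) : ℝ) with hb
  set δ := b • e - (s β - s τ) with hδ
  have L1' : ∑ v ∈ range N, s1 v = ∑ v ∈ range N, s v + δ := by
    rw [L1, hδ]; abel
  have L2' : ∑ v ∈ range N, s2 v = ∑ v ∈ range N, s v + δ + δ := by
    rw [L2, L1', hδ]; abel
  have Q : ∑ v ∈ range N, B (s2 v) (s2 v) + ∑ v ∈ range N, B (s v) (s v)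
      - 2 * ∑ v ∈ range N, B (s1 v) (s1 v) = 2 * B δ e := by
    rw [q2, q1]
    have r1 : ∑ v ∈ Ico τ β, (B (s v + e + e) (s v + e + e) - B (s v + e) (s v + e)) =
       ∑ v ∈ Ico τ β, (B (s v + e) (s v + e) - B (s v) (s v)) + 2 * (b * B e e) := by
      have : 2 * (b * B e e) = ∑ v ∈ Ico τ β, 2 * B e e := by
        simp [hb]; ring
      rw [this, ← Finset.sum_add_distrib]
      apply Finset.sum_congr rfl
      intro v _
      simp only [map_add, LinearMap.add_apply]
      ring
    rw [r1, hδ]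
    simp only [map_add, LinearMap.add_apply, map_sub, LinearMap.sub_apply, map_smul, LinearMap.smul_apply,
      smul_eq_mul, hB e]
    ring
  rw [QQ_eq, QQ_eq, QQ_eq, L1', L2']
  have : B (∑ v ∈ range N, s v + δ + δ) (∑ v ∈ range N, s v + δ + δ) +
    B (∑ v ∈ range N, s v) (∑ v ∈ range N, s v) - 2 * B (∑ v ∈ range N, s v + δ) (∑ v ∈ range N, s v + δ)
      = 2 * B δ δ := by
    simp only [map_add, LinearMap.add_apply]
    ring
  linear_combination 2 * N * Q - 2 * this

/-- admissible chord data -/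
structure Ch (n : ℕ) (t b : ℕ → ℕ) : Prop where
  n3 : 3 ≤ n
  t0 : t 0 = 0
  b0 : b 0 = 6 * n + 2
  bn : b n = t n
  tm : ∀ j k, j < k → k ≤ n → t j < t k
  bm : ∀ j k, j < k → k ≤ n → b k < b j
  len : ∀ k, 1 ≤ k → k < n → b k = t k + 6 * (n - k) + 1

theorem Ch.le {n : ℕ} {t b : ℕ → ℕ} (h : Ch n t b) (k : ℕ) (hk : k ≤ n) : t k ≤ b k := by
  rcases Nat.eq_zero_or_pos k with rfl | h0
  · rw [h.t0]; omega
  · rcases Nat.lt_or_ge k n with h1 | h1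
    · have := h.len k h0 h1; omega
    · have : k = n := by omega
      subst this; exact h.bn.ge

/-- number of positions below `v` in `[t,b)` -/
def hh (t b v : ℕ) : ℝ := ((min v b : ℕ) : ℝ) - ((min v t : ℕ) : ℝ)

/-- indicator of `[t,b)` -/
def zt (t b e : ℕ) : ℝ := if t ≤ e ∧ e < b then 1 else 0

theorem hh_succ {t b : ℕ} (h : t ≤ b) (v : ℕ) : hh t b (v + 1) = hh t b v + zt t b v := by
  unfold hh zt
  split_ifs with h1
  · rw [min_eq_left (by omega : v + 1 ≤ b), min_eq_left (by omega : v ≤ b),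
      min_eq_right (by omega : t ≤ v + 1), min_eq_right (by omega : t ≤ v)]
    push_cast; ring
  · rcases Nat.lt_or_ge v t with h2 | h2
    · rw [min_eq_left (by omega : v + 1 ≤ b), min_eq_left (by omega : v ≤ b),
        min_eq_left (by omega : v + 1 ≤ t), min_eq_left (by omega : v ≤ t)]
      ring
    · rw [min_eq_right (by omega : b ≤ v + 1), min_eq_right (by omega : b ≤ v),
        min_eq_right (by omega : t ≤ v + 1), min_eq_right (by omega : t ≤ v)]
      ring

theorem sum_zt {t b : ℕ} (h : t ≤ b) {u v : ℕ} (huv : u ≤ v) :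
    ∑ e ∈ Ico u v, zt t b e = hh t b v - hh t b u := by
  rw [← Finset.sum_Ico_sub (hh t b) huv]
  apply Finset.sum_congr rfl
  intro e _
  rw [hh_succ h]; ring

/-- cumulative label count -/
def sv (n : ℕ) (t b : ℕ → ℕ) (v : ℕ) : Fin n → ℝ := fun j =>
  hh (t j) (b j) v - hh (t (j + 1)) (b (j + 1)) v

/-- edge values -/
def YY {n : ℕ} (t b : ℕ → ℕ) (y : Fin n → ℝ) (e : ℕ) : ℝ :=
  ∑ j ∈ range n, ext y j * (zt (t j) (b j) e - zt (t (j + 1)) (b (j + 1)) e)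

theorem sum_YY {n : ℕ} {t b : ℕ → ℕ} (h : Ch n t b) (y : Fin n → ℝ) {u v : ℕ} (huv : u ≤ v) :
    ∑ e ∈ Ico u v, YY t b y e = ∑ j ∈ range n, ext y j *
      ((hh (t j) (b j) v - hh (t j) (b j) u)
        - (hh (t (j + 1)) (b (j + 1)) v - hh (t (j + 1)) (b (j + 1)) u)) := by
  unfold YY
  rw [Finset.sum_comm]
  apply Finset.sum_congr rfl
  intro j hj
  have hj := Finset.mem_range.1 hj
  rw [← Finset.mul_sum, Finset.sum_sub_distrib, sum_zt (h.le j (by omega)) huv,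
    sum_zt (h.le (j + 1) (by omega)) huv]

theorem sum_YY' {n : ℕ} {t b : ℕ → ℕ} (h : Ch n t b) (y : Fin n → ℝ) {u v : ℕ} (huv : u ≤ v) :
    ∑ e ∈ Ico u v, YY t b y e = (sv n t b v - sv n t b u) ⬝ᵥ y := by
  rw [sum_YY h y huv, dotProduct, ← Fin.sum_univ_eq_sum_range (fun j => ext y j *
      ((hh (t j) (b j) v - hh (t j) (b j) u)
        - (hh (t (j + 1)) (b (j + 1)) v - hh (t (j + 1)) (b (j + 1)) u)))]
  apply Finset.sum_congr rfl
  intro j _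
  rw [ext_fin]
  simp only [sv, Pi.sub_apply]
  ring

theorem hh_in {n : ℕ} {t b : ℕ → ℕ} (h : Ch n t b) (j k : ℕ) (hj : j ≤ n) (hk : k ≤ n) :
    hh (t j) (b j) (b k) - hh (t j) (b j) (t k) =
      if j ≤ k then (b k : ℝ) - t k else (b j : ℝ) - t j := by
  have l1 := h.le j hj
  have l2 := h.le k hk
  unfold hh
  split_ifs with hjk
  · have a1 : t j ≤ t k := by
      rcases Nat.eq_or_lt_of_le hjk with rfl | hlt
      · exact le_rfl
      · exact (h.tm _ _ hlt hk).le
    have a2 : b k ≤ b j := by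
      rcases Nat.eq_or_lt_of_le hjk with rfl | hlt
      · exact le_rfl
      · exact (h.bm _ _ hlt hk).le
    rw [min_eq_left a2, min_eq_left (by omega : t k ≤ b j), min_eq_right (by omega : t j ≤ b k),
      min_eq_right a1]
    ring
  · have a1 := h.tm k j (by omega) hj
    have a2 := h.bm k j (by omega) hj
    rw [min_eq_right a2.le, min_eq_left (by omega : t k ≤ b j), min_eq_right (by omega : t j ≤ b k),
      min_eq_left a1.le]
    ring

theorem Ch.lenr {n : ℕ} {t b : ℕ → ℕ} (h : Ch n t b) (k : ℕ) (hk : k ≤ n) :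
    (b k : ℝ) - t k = 6 * (n - k) + (if k = n then 0 else 1) + (if k = 0 then 1 else 0) := by
  have n3 := h.n3
  rcases Nat.eq_zero_or_pos k with rfl | h0
  · rw [h.t0, h.b0, if_neg (by omega), if_pos rfl]; push_cast; ring
  · rcases Nat.lt_or_ge k n with h1 | h1
    · rw [h.len k h0 h1, if_neg (by omega), if_neg (by omega)]
      push_cast [Nat.cast_sub hk]; ring
    · have : k = n := by omega
      subst this
      rw [h.bn, if_pos rfl, if_neg (by omega)]; ring

/-- number of outer edges of the `j`-th octagon beyond the chord `k` -/
def cnt (n k j : ℕ) : ℝ :=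
  if j < k then 0 else 6 + (if j = 0 then 1 else 0) + (if j + 1 = n then 1 else 0)

theorem cnt_eq {n : ℕ} {t b : ℕ → ℕ} (h : Ch n t b) (j k : ℕ) (hj : j < n) (hk : k < n) :
    (hh (t j) (b j) (b k) - hh (t j) (b j) (t k)) -
      (hh (t (j + 1)) (b (j + 1)) (b k) - hh (t (j + 1)) (b (j + 1)) (t k)) = cnt n k j := by
  rw [hh_in h j k (by omega) (by omega), hh_in h (j + 1) k (by omega) (by omega)]
  have n3 := h.n3
  unfold cnt
  by_cases h1 : j < k
  · rw [if_pos h1.le, if_pos (by omega), if_pos h1]; ring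
  · rw [if_neg h1, if_neg (by omega : ¬ j + 1 ≤ k)]
    have : (if j ≤ k then (b k : ℝ) - t k else (b j : ℝ) - t j) = (b j : ℝ) - t j := by
      split_ifs with h2
      · have : j = k := by omega
        rw [this]
      · rfl
    rw [this, h.lenr j (by omega), h.lenr (j + 1) (by omega), if_neg (by omega : ¬ j = n),
      if_neg (by omega : ¬ j + 1 = 0)]
    push_cast
    split_ifs <;> ring

theorem tele {n : ℕ} (hn : 3 ≤ n) (y c : Fin n → ℝ) (hy : MM n *ᵥ y = c) (k : ℕ) (hk : k < n) :
    ∑ j ∈ range n, ext y j * cnt n k j = ∑ j ∈ Ico k n, ext c j +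
      (if k = 0 then 0 else ext y (k - 1) - ext y k) := by
  have hc : ∀ j, j < n → ext c j = 8 * ext y j - ext y (j + 1) - prv y j := by
    intro j hj
    have := congrFun hy ⟨j, hj⟩
    rw [MM_mulVec] at this
    rw [show ext c j = c ⟨j, hj⟩ by simp [ext, hj], ← this]
    simp [ext, hj]
  have bot : ∀ (f : ℕ → ℝ) k, k < n → ∑ j ∈ Ico k n, f j = f k + ∑ j ∈ Ico (k + 1) n, f j :=
    fun f k hk => Finset.sum_eq_sum_Ico_succ_bot hk f
  have hyn : ext y n = 0 := by simp [ext]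
  have e1 : ∀ k, k ≤ n → ∑ j ∈ range n, ext y j * cnt n k j = ∑ j ∈ Ico k n, ext y j * cnt n 0 j := by
    intro k hk
    rw [← Finset.sum_range_add_sum_Ico _ hk]
    have z : ∑ j ∈ range k, ext y j * cnt n k j = 0 := by
      apply Finset.sum_eq_zero
      intro j hj
      simp at hj
      simp [cnt, hj]
    rw [z, zero_add]
    apply Finset.sum_congr rfl
    intro j hj
    simp at hj
    simp [cnt, show ¬ j < k by omega]
  rw [e1 k hk.le]
  clear e1
  have main : ∀ m, ∀ k, 1 ≤ k → k + 1 + m = n → ∑ j ∈ Ico k n, ext y j * cnt n 0 j =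
      ∑ j ∈ Ico k n, ext c j + (ext y (k - 1) - ext y k) := by
    intro m
    induction m with
    | zero =>
      intro k h1 h2
      have : n = k + 1 := by omega
      have hck := hc k (by omega)
      rw [show k + 1 = n by omega, hyn] at hck
      rw [bot (fun j => ext y j * cnt n 0 j) k (by omega), bot (ext c) k (by omega),
        Finset.Ico_eq_empty (by omega), Finset.sum_empty, Finset.sum_empty, hck]
      simp only [cnt, prv, if_neg (show ¬ k = 0 by omega), if_pos (show k + 1 = n by omega)]
      simp
      ring
    | succ m ih =>
      intro k h1 h2
      have hck := hc k (by omega)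
      rw [bot (fun j => ext y j * cnt n 0 j) k (by omega), bot (ext c) k (by omega),
        ih (k + 1) (by omega) (by omega), hck]
      simp only [cnt, prv, if_neg (show ¬ k = 0 by omega), if_neg (show ¬ k + 1 = n by omega)]
      simp
      ring
  rcases Nat.eq_zero_or_pos k with rfl | h0
  · rw [bot (fun j => ext y j * cnt n 0 j) 0 (by omega), bot (ext c) 0 (by omega),
      main (n - 2) 1 le_rfl (by omega), hc 0 (by omega)]
    simp only [cnt, prv, if_neg (show ¬ 0 + 1 = n by omega)]
    simp
    ring
  · rw [main (n - k - 1) k h0 (by omega), if_neg (by omega)]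

theorem abel_sum (y z : ℕ → ℝ) (m : ℕ) :
    ∑ j ∈ range (m + 1), y j * (z j - z (j + 1)) =
      y 0 * z 0 + ∑ k ∈ Ico 1 (m + 1), (y k - y (k - 1)) * z k - y m * z (m + 1) := by
  induction m with
  | zero => simp; ring
  | succ m ih =>
    rw [Finset.sum_range_succ, ih, Finset.sum_Ico_succ_top (by omega : 1 ≤ m + 1), Nat.add_sub_cancel]
    ring

section pot
variable {n : ℕ} (t b : ℕ → ℕ) (u v : ℕ)

/-- mesh currents -/
noncomputable def yy (n : ℕ) (t b : ℕ → ℕ) (u v : ℕ) : Fin n → ℝ :=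
  (MM n)⁻¹ *ᵥ (sv n t b v - sv n t b u)

/-- boundary currents -/
noncomputable def ff (n : ℕ) (t b : ℕ → ℕ) (u v : ℕ) (e : ℕ) : ℝ :=
  zt u v e - YY t b (yy n t b u v) e

/-- potentials -/
noncomputable def xx (n : ℕ) (t b : ℕ → ℕ) (u v : ℕ) (a : ℕ) : ℝ :=
  - ∑ e ∈ range a, ff n t b u v e

end pot

theorem xx_sub (n : ℕ) (t b : ℕ → ℕ) (u v : ℕ) {a d : ℕ} (h : a ≤ d) :
    xx n t b u v a - xx n t b u v d = ∑ e ∈ Ico a d, ff n t b u v e := by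
  unfold xx
  rw [Finset.sum_Ico_eq_sub _ h]; ring

theorem xx_chord {n : ℕ} {t b : ℕ → ℕ} (h : Ch n t b) {u v : ℕ} (huv : u ≤ v) (k : ℕ) (hk : k < n) :
    xx n t b u v (t k) - xx n t b u v (b k) =
      if k = 0 then 0 else ext (yy n t b u v) k - ext (yy n t b u v) (k - 1) := by
  rw [xx_sub _ _ _ _ _ (h.le k hk.le)]
  unfold ff
  rw [Finset.sum_sub_distrib, sum_zt huv (h.le k hk.le), sum_YY h _ (h.le k hk.le)]
  have e1 : ∀ j ∈ range n, ext (yy n t b u v) j * ((hh (t j) (b j) (b k) - hh (t j) (b j) (t k)) -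
      (hh (t (j + 1)) (b (j + 1)) (b k) - hh (t (j + 1)) (b (j + 1)) (t k))) =
      ext (yy n t b u v) j * cnt n k j := by
    intro j hj
    rw [cnt_eq h j k (Finset.mem_range.1 hj) hk]
  rw [Finset.sum_congr rfl e1, tele h.n3 (yy n t b u v) _ (MM_sol (sv n t b v - sv n t b u)) k hk]
  have e2 : ∑ j ∈ Ico k n, ext (sv n t b v - sv n t b u) j =
      hh (t k) (b k) v - hh (t k) (b k) u := by
    have := Finset.sum_Ico_sub (fun j => -(hh (t j) (b j) v - hh (t j) (b j) u)) hk.le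
    have hz : hh (t n) (b n) v - hh (t n) (b n) u = 0 := by
      rw [h.bn]; simp [hh]
    rw [hz] at this
    rw [show hh (t k) (b k) v - hh (t k) (b k) u = -0 - -(hh (t k) (b k) v - hh (t k) (b k) u) by ring,
      ← this]
    apply Finset.sum_congr rfl
    intro j hj
    simp at hj
    simp only [ext, hj.2, dif_pos, Pi.sub_apply, sv]
    ring
  rw [e2]
  have e3 : hh u v (b k) - hh u v (t k) = hh (t k) (b k) v - hh (t k) (b k) u := by
    unfold hh
    rw [min_comm v (b k), min_comm v (t k), min_comm u (b k), min_comm u (t k)]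
    ring
  rw [e3]
  split_ifs <;> ring

theorem zt_diff {u v : ℕ} (huv : u < v) (a : ℕ) :
    zt u v (a + 1) - zt u v a = (if a + 1 = u then 1 else 0) - (if a + 1 = v then 1 else 0) := by
  unfold zt
  split_ifs <;> first | omega | norm_num

theorem YY_eq {n : ℕ} {t b : ℕ → ℕ} (h : Ch n t b) (y : Fin n → ℝ) (e : ℕ) :
    YY t b y e = ext y 0 * zt (t 0) (b 0) e +
      ∑ k ∈ Ico 1 n, (ext y k - ext y (k - 1)) * zt (t k) (b k) e := by
  obtain ⟨m, rfl⟩ : ∃ m, n = m + 1 := ⟨n - 1, by have := h.n3; omega⟩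
  have := abel_sum (ext y) (fun j => zt (t j) (b j) e) m
  unfold YY
  rw [this, h.bn]
  have : zt (t (m + 1)) (t (m + 1)) e = 0 := by
    unfold zt; rw [if_neg]; omega
  rw [this]; ring

theorem vertex_eq {n : ℕ} {t b : ℕ → ℕ} (h : Ch n t b) {u v : ℕ} (huv : u < v) (hv : v < 6 * n + 2)
    (a : ℕ) (ha : a < 6 * n + 2) :
    ff n t b u v a - ff n t b u v (if a = 0 then 6 * n + 1 else a - 1)
      + ∑ k ∈ Ico 1 n, ((if a = t k then 1 else 0) - (if a = b k then 1 else 0)) *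
        (xx n t b u v (t k) - xx n t b u v (b k)) =
      (if a = u then 1 else 0) - (if a = v then 1 else 0) := by
  have n3 := h.n3
  have hr : ∀ k ∈ Ico 1 n, 0 < t k ∧ t k < b k ∧ b k < 6 * n + 2 := by
    intro k hk
    simp at hk
    have h1 := h.tm 0 k (by omega) (by omega)
    have h2 := h.bm 0 k (by omega) (by omega)
    have h3 := h.len k (by omega) (by omega)
    rw [h.b0] at h2
    omega
  set y := yy n t b u v with hy
  have e1 : ∑ k ∈ Ico 1 n, ((if a = t k then (1:ℝ) else 0) - (if a = b k then 1 else 0)) *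
        (xx n t b u v (t k) - xx n t b u v (b k)) =
      ∑ k ∈ Ico 1 n, (ext y k - ext y (k - 1)) *
       (zt (t k) (b k) a - zt (t k) (b k) (if a = 0 then 6 * n + 1 else a - 1)) := by
    apply Finset.sum_congr rfl
    intro k hk
    obtain ⟨r1, r2, r3⟩ := hr k hk
    simp at hk
    rw [xx_chord h huv.le k hk.2, if_neg (by omega : ¬ k = 0), mul_comm]
    congr 1
    rcases Nat.eq_zero_or_pos a with rfl | h0
    · unfold zt
      rw [if_neg (by omega), if_neg (by omega), if_pos rfl, if_neg (by omega), if_neg (by omega)]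
    · obtain ⟨d, rfl⟩ : ∃ d, a = d + 1 := ⟨a - 1, by omega⟩
      rw [if_neg (by omega : ¬ d + 1 = 0), Nat.add_sub_cancel, zt_diff r2]
  rw [e1]
  unfold ff
  rw [← hy, YY_eq h, YY_eq h]
  have e2 : ∀ e, e < 6 * n + 2 → zt (t 0) (b 0) e = 1 := by
    intro e he; unfold zt; rw [h.t0, h.b0, if_pos]; omega
  rw [e2 a ha, e2 (if a = 0 then 6 * n + 1 else a - 1) (by split_ifs <;> omega)]
  simp only [mul_sub, Finset.sum_sub_distrib]
  have e3 : zt u v a - zt u v (if a = 0 then 6 * n + 1 else a - 1) =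
      (if a = u then 1 else 0) - (if a = v then 1 else 0) := by
    rcases Nat.eq_zero_or_pos a with rfl | h0
    · unfold zt
      rw [if_pos (rfl : (0:ℕ) = 0), if_neg (by omega : ¬ (u ≤ 6 * n + 1 ∧ 6 * n + 1 < v)),
        if_neg (by omega : ¬ 0 = v)]
      split_ifs <;> first | omega | norm_num
    · obtain ⟨d, rfl⟩ : ∃ d, a = d + 1 := ⟨a - 1, by omega⟩
      rw [if_neg (by omega : ¬ d + 1 = 0), Nat.add_sub_cancel, zt_diff huv]
  rw [← e3]
  ring

/-- chain from chord data -/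
def octG (n : ℕ) (t b : ℕ → ℕ) : SimpleGraph (Fin (6 * n + 2)) :=
  SimpleGraph.fromRel (fun x y =>
    ((x : ℕ) + 1 = (y : ℕ)) ∨ ((x : ℕ) = 6 * n + 1 ∧ (y : ℕ) = 0) ∨
    ∃ k, 1 ≤ k ∧ k ≤ n - 1 ∧ (x : ℕ) = t k ∧ (y : ℕ) = b k)

open Classical in
theorem glap_mulVec {V : Type} [Fintype V] (G : SimpleGraph V) (x : V → ℝ) (a : V) :
    (glap G *ᵥ x) a = ∑ c, (if G.Adj a c then (1 : ℝ) else 0) * (x a - x c) := by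
  change ∑ c, glap G a c * x c = _
  have h : ∀ c, glap G a c * x c = (if a = c then
      ((Finset.univ.filter (fun t => G.Adj a t)).card : ℝ) * x a else 0) -
      (if G.Adj a c then (1 : ℝ) else 0) * x c := by
    intro c
    unfold glap
    by_cases h : a = c
    · subst h; simp
    · by_cases h' : G.Adj a c <;> simp [h, h']
  simp only [h, Finset.sum_sub_distrib, mul_sub, ← Finset.sum_mul]
  simp

/-- directed edge indicator -/
def rr (n : ℕ) (t b : ℕ → ℕ) (x y : ℕ) : ℝ :=
  (if y = (if x = 6 * n + 1 then 0 else (x : ℕ) + 1) then 1 else 0) +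
    ∑ k ∈ Ico 1 n, (if x = t k ∧ y = b k then 1 else 0)

theorem Ch.rng {n : ℕ} {t b : ℕ → ℕ} (h : Ch n t b) (k : ℕ) (h1 : 1 ≤ k) (h2 : k < n) :
    0 < t k ∧ t k + 6 < b k ∧ b k < 6 * n + 2 := by
  have a1 := h.tm 0 k (by omega) (by omega)
  have a2 := h.bm 0 k (by omega) (by omega)
  have a3 := h.len k (by omega) (by omega)
  rw [h.b0] at a2
  omega

open Classical in
theorem rr_eq {n : ℕ} {t b : ℕ → ℕ} (h : Ch n t b) (x y : ℕ) :
    rr n t b x y = if (y = (if x = 6 * n + 1 then 0 else (x : ℕ) + 1)) ∨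
      (∃ k, 1 ≤ k ∧ k < n ∧ x = t k ∧ y = b k) then 1 else 0 := by
  unfold rr
  have e : ∑ k ∈ Ico 1 n, (if x = t k ∧ y = b k then (1:ℝ) else 0) =
      if (∃ k, 1 ≤ k ∧ k < n ∧ x = t k ∧ y = b k) then 1 else 0 := by
    split_ifs with h1
    · obtain ⟨k, k1, k2, k3, k4⟩ := h1
      rw [Finset.sum_eq_single k]
      · rw [if_pos ⟨k3, k4⟩]
      · intro j hj hjk
        simp at hj
        rw [if_neg]
        rintro ⟨j1, _⟩
        rcases Nat.lt_or_gt_of_ne hjk with hlt | hlt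
        · have := h.tm _ _ hlt k2.le; omega
        · have := h.tm _ _ hlt hj.2.le; omega
      · intro hk; simp at hk; omega
    · apply Finset.sum_eq_zero
      intro k hk
      simp at hk
      rw [if_neg]
      exact fun hh => h1 ⟨k, hk.1, hk.2, hh⟩
  rw [e]
  by_cases h1 : y = (if x = 6 * n + 1 then 0 else (x : ℕ) + 1)
  · rw [if_pos h1, if_pos (Or.inl h1), if_neg]
    · ring
    · rintro ⟨k, k1, k2, k3, k4⟩
      have := h.rng k k1 k2
      split_ifs at h1 <;> omega
  · rw [if_neg h1]
    simp [h1]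

open Classical in
theorem adj_ind {n : ℕ} {t b : ℕ → ℕ} (h : Ch n t b) (x y : Fin (6 * n + 2)) :
    (if (octG n t b).Adj x y then (1 : ℝ) else 0) = rr n t b x y + rr n t b y x := by
  rw [rr_eq h, rr_eq h]
  have n3 := h.n3
  have hx := x.2
  have hy := y.2
  have R : ∀ x y : Fin (6 * n + 2), (((x : ℕ) + 1 = (y : ℕ)) ∨ ((x : ℕ) = 6 * n + 1 ∧ (y : ℕ) = 0) ∨
    ∃ k, 1 ≤ k ∧ k ≤ n - 1 ∧ (x : ℕ) = t k ∧ (y : ℕ) = b k) ↔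
     (((y : ℕ) = (if (x : ℕ) = 6 * n + 1 then 0 else (x : ℕ) + 1)) ∨
      (∃ k, 1 ≤ k ∧ k < n ∧ (x : ℕ) = t k ∧ (y : ℕ) = b k)) := by
    intro x y
    have hx := x.2
    have hy := y.2
    have e : (∃ k, 1 ≤ k ∧ k ≤ n - 1 ∧ (x : ℕ) = t k ∧ (y : ℕ) = b k) ↔
      (∃ k, 1 ≤ k ∧ k < n ∧ (x : ℕ) = t k ∧ (y : ℕ) = b k) :=
      exists_congr fun k => by
        constructor
        · rintro ⟨a1, a2, a3⟩; exact ⟨a1, by omega, a3⟩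
        · rintro ⟨a1, a2, a3⟩; exact ⟨a1, by omega, a3⟩
    rw [e, ← or_assoc]
    apply or_congr_left
    split_ifs <;> omega
  have hne : ∀ x y : Fin (6 * n + 2), (((y : ℕ) = (if (x : ℕ) = 6 * n + 1 then 0 else (x : ℕ) + 1)) ∨
      (∃ k, 1 ≤ k ∧ k < n ∧ (x : ℕ) = t k ∧ (y : ℕ) = b k)) → x ≠ y ∧
      ¬ (((x : ℕ) = (if (y : ℕ) = 6 * n + 1 then 0 else (y : ℕ) + 1)) ∨
      (∃ k, 1 ≤ k ∧ k < n ∧ (y : ℕ) = t k ∧ (x : ℕ) = b k)) := by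
    intro x y hxy
    have hx := x.2
    have hy := y.2
    rcases hxy with h1 | ⟨k, k1, k2, k3, k4⟩
    · constructor
      · rintro rfl; split_ifs at h1 <;> omega
      · rintro (h2 | ⟨k, k1, k2, k3, k4⟩)
        · split_ifs at h1 h2 <;> omega
        · have := h.rng k k1 k2
          split_ifs at h1 <;> omega
    · have := h.rng k k1 k2
      constructor
      · rintro rfl; omega
      · rintro (h2 | ⟨j, j1, j2, j3, j4⟩)
        · split_ifs at h2 <;> omega
        · have := h.rng j j1 j2
          omega
  have A : (octG n t b).Adj x y ↔ x ≠ y ∧ ((((y : ℕ) = (if (x : ℕ) = 6 * n + 1 then 0 else (x : ℕ) + 1)) ∨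
      (∃ k, 1 ≤ k ∧ k < n ∧ (x : ℕ) = t k ∧ (y : ℕ) = b k)) ∨
      (((x : ℕ) = (if (y : ℕ) = 6 * n + 1 then 0 else (y : ℕ) + 1)) ∨
      (∃ k, 1 ≤ k ∧ k < n ∧ (y : ℕ) = t k ∧ (x : ℕ) = b k))) := by
    rw [octG, SimpleGraph.fromRel_adj, R x y, R y x]
  by_cases p1 : (((y : ℕ) = (if (x : ℕ) = 6 * n + 1 then 0 else (x : ℕ) + 1)) ∨
      (∃ k, 1 ≤ k ∧ k < n ∧ (x : ℕ) = t k ∧ (y : ℕ) = b k))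
  · have := hne x y p1
    rw [if_pos p1, if_neg this.2, if_pos (A.2 ⟨this.1, Or.inl p1⟩)]; ring
  · by_cases p2 : (((x : ℕ) = (if (y : ℕ) = 6 * n + 1 then 0 else (y : ℕ) + 1)) ∨
      (∃ k, 1 ≤ k ∧ k < n ∧ (y : ℕ) = t k ∧ (x : ℕ) = b k))
    · have := hne y x p2
      rw [if_neg p1, if_pos p2, if_pos (A.2 ⟨this.1.symm, Or.inr p2⟩)]; ring
    · rw [if_neg p1, if_neg p2, if_neg]
      · ring
      · rw [A]; rintro ⟨_, q | q⟩
        · exact p1 q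
        · exact p2 q

theorem lap_sum {n : ℕ} {t b : ℕ → ℕ} (h : Ch n t b) (X : ℕ → ℝ) (a : Fin (6 * n + 2)) :
    (glap (octG n t b) *ᵥ (fun c => X c)) a =
      (X a - X (if (a : ℕ) = 6 * n + 1 then 0 else (a : ℕ) + 1)) +
      (X a - X (if (a : ℕ) = 0 then 6 * n + 1 else (a : ℕ) - 1)) +
      ∑ k ∈ Ico 1 n, ((if (a : ℕ) = t k then 1 else 0) - (if (a : ℕ) = b k then 1 else 0)) *
        (X (t k) - X (b k)) := by
  have ha := a.2
  rw [glap_mulVec]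
  simp only [adj_ind h, add_mul, Finset.sum_add_distrib]
  rw [Fin.sum_univ_eq_sum_range (fun c => rr n t b a c * (X a - X c)),
    Fin.sum_univ_eq_sum_range (fun c => rr n t b c a * (X a - X c))]
  have e1 : ∑ c ∈ range (6 * n + 2), rr n t b a c * (X a - X c) =
      (X a - X (if (a : ℕ) = 6 * n + 1 then 0 else (a : ℕ) + 1)) +
      ∑ k ∈ Ico 1 n, (if (a : ℕ) = t k then 1 else 0) * (X (t k) - X (b k)) := by
    unfold rr
    simp only [add_mul, Finset.sum_add_distrib, Finset.sum_mul]
    congr 1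
    · rw [Finset.sum_eq_single (if (a : ℕ) = 6 * n + 1 then 0 else (a : ℕ) + 1)]
      · rw [if_pos rfl, one_mul]
      · intro c _ hc; rw [if_neg hc, zero_mul]
      · intro hc; exfalso; apply hc; simp; split_ifs <;> omega
    · rw [Finset.sum_comm]
      apply Finset.sum_congr rfl
      intro k hk
      simp at hk
      have := h.rng k hk.1 hk.2
      rw [Finset.sum_eq_single (b k)]
      · by_cases q : (a : ℕ) = t k <;> simp [q]
      · intro c _ hc; rw [if_neg (fun q => hc q.2), zero_mul]
      · intro hc; exfalso; apply hc; simp; omega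
  have e2 : ∑ c ∈ range (6 * n + 2), rr n t b c a * (X a - X c) =
      (X a - X (if (a : ℕ) = 0 then 6 * n + 1 else (a : ℕ) - 1)) +
      ∑ k ∈ Ico 1 n, (if (a : ℕ) = b k then 1 else 0) * (X (b k) - X (t k)) := by
    unfold rr
    simp only [add_mul, Finset.sum_add_distrib, Finset.sum_mul]
    congr 1
    · rw [Finset.sum_eq_single (if (a : ℕ) = 0 then 6 * n + 1 else (a : ℕ) - 1)]
      · rw [if_pos, one_mul]
        split_ifs <;> omega
      · intro c hc hne
        simp at hc
        rw [if_neg, zero_mul]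
        split_ifs at hne ⊢ <;> omega
      · intro hc; exfalso; apply hc; simp; split_ifs <;> omega
    · rw [Finset.sum_comm]
      apply Finset.sum_congr rfl
      intro k hk
      simp at hk
      have := h.rng k hk.1 hk.2
      rw [Finset.sum_eq_single (t k)]
      · by_cases q : (a : ℕ) = b k <;> simp [q]
      · intro c _ hc; rw [if_neg (fun q => hc q.1), zero_mul]
      · intro hc; exfalso; apply hc; simp; omega
  rw [e1, e2]
  have e3 : ∑ k ∈ Ico 1 n, ((if (a : ℕ) = t k then (1:ℝ) else 0) - (if (a : ℕ) = b k then 1 else 0)) *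
        (X (t k) - X (b k)) = ∑ k ∈ Ico 1 n, (if (a : ℕ) = t k then (1:ℝ) else 0) * (X (t k) - X (b k)) +
      ∑ k ∈ Ico 1 n, (if (a : ℕ) = b k then (1:ℝ) else 0) * (X (b k) - X (t k)) := by
    rw [← Finset.sum_add_distrib]
    apply Finset.sum_congr rfl
    intro k _
    ring
  rw [e3]
  ring

theorem res_lt {n : ℕ} {t b : ℕ → ℕ} (h : Ch n t b) (u v : Fin (6 * n + 2)) (huv : (u : ℕ) < v) :
    resDist (octG n t b) u v = ((v : ℕ) : ℝ) - (u : ℕ) -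
      BB n (sv n t b v - sv n t b u) (sv n t b v - sv n t b u) := by
  have hxN : xx n t b u v (6 * n + 2) = xx n t b u v 0 := by
    have := xx_chord h huv.le 0 (by have := h.n3; omega)
    rw [h.t0, h.b0, if_pos rfl] at this
    linarith
  have hstep : ∀ a, xx n t b u v a - xx n t b u v (a + 1) = ff n t b u v a := by
    intro a; rw [xx_sub _ _ _ _ _ (Nat.le_succ a)]; simp
  have hL : glap (octG n t b) *ᵥ (fun c => xx n t b u v c) = Pi.single u 1 - Pi.single v 1 := by
    ext a
    have ha := a.2
    rw [lap_sum h]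
    have := vertex_eq h huv v.2 a a.2
    have q1 : xx n t b u v a - xx n t b u v (if (a : ℕ) = 6 * n + 1 then 0 else (a : ℕ) + 1) =
        ff n t b u v a := by
      rw [← hstep]
      split_ifs with q
      · rw [q, hxN]
      · rfl
    have q2 : xx n t b u v a - xx n t b u v (if (a : ℕ) = 0 then 6 * n + 1 else (a : ℕ) - 1) =
        - ff n t b u v (if (a : ℕ) = 0 then 6 * n + 1 else (a : ℕ) - 1) := by
      rw [← hstep]
      split_ifs with q
      · rw [q, hxN]; ring
      · rw [Nat.sub_add_cancel (by omega)]; ring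
    rw [q1, q2]
    simp only [Pi.sub_apply, Pi.single_apply, Fin.ext_iff]
    rw [← this]
    ring
  rw [resDist_eq _ u v _ hL, xx_sub _ _ _ _ _ huv.le]
  unfold ff
  rw [Finset.sum_sub_distrib, sum_YY' h _ huv.le, sum_zt huv.le huv.le, BB_apply, yy]
  congr 1
  simp [hh, huv.le]

theorem kirchhoff_eq {n : ℕ} {t b : ℕ → ℕ} (h : Ch n t b) :
    kirchhoff (octG n t b) = (∑ u : Fin (6 * n + 2), ∑ v : Fin (6 * n + 2), |((v : ℕ) : ℝ) - (u : ℕ)|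
      - QQ (BB n) (6 * n + 2) (sv n t b)) / 2 := by
  have hr : ∀ u v : Fin (6 * n + 2), resDist (octG n t b) u v = |((v : ℕ) : ℝ) - (u : ℕ)| -
      BB n (sv n t b v - sv n t b u) (sv n t b v - sv n t b u) := by
    intro u v
    rcases lt_trichotomy (u : ℕ) (v : ℕ) with hlt | heq | hlt
    · have : ((u : ℕ) : ℝ) < (v : ℕ) := by exact_mod_cast hlt
      rw [res_lt h u v hlt, abs_of_pos (by linarith)]
    · have : u = v := Fin.ext heq
      subst this
      simp [resDist]
    · have : ((v : ℕ) : ℝ) < (u : ℕ) := by exact_mod_cast hlt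
      have hs : resDist (octG n t b) u v = resDist (octG n t b) v u := by
        unfold resDist; ring
      rw [hs, res_lt h v u hlt, abs_of_neg (by linarith), ← neg_sub (sv n t b v) (sv n t b u)]
      simp only [map_neg, LinearMap.neg_apply]
      ring
  unfold kirchhoff QQ
  simp only [hr, Finset.sum_sub_distrib]
  congr 2
  rw [← Fin.sum_univ_eq_sum_range (fun u => ∑ v ∈ range (6 * n + 2), BB n (sv n t b v - sv n t b u) (sv n t b v - sv n t b u))]
  apply Finset.sum_congr rfl
  intro u _
  rw [← Fin.sum_univ_eq_sum_range (fun v => BB n (sv n t b v - sv n t b u) (sv n t b v - sv n t b u))]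

theorem sv_shift {n : ℕ} {t b t' b' : ℕ → ℕ} (h : Ch n t b) (h' : Ch n t' b') (i : ℕ)
    (hi : i + 1 < n) (q1 : ∀ k, k ≤ i → t' k = t k ∧ b' k = b k)
    (q2 : ∀ k, i < k → k ≤ n → t' k = t k + 1 ∧ b' k = b k + 1) :
    (∀ v ≤ t (i + 1), sv n t' b' v = sv n t b v) ∧
    (∀ v, t (i + 1) ≤ v → v ≤ b (i + 1) →
      sv n t' b' (v + 1) = sv n t b v + Pi.single ⟨i, by omega⟩ 1) ∧
    (∀ v, b (i + 1) < v → sv n t' b' v = sv n t b v) := by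
  have lo : ∀ k v, k ≤ i → hh (t' k) (b' k) v = hh (t k) (b k) v := by
    intro k v hk; rw [(q1 k hk).1, (q1 k hk).2]
  have tge : ∀ k, i < k → k ≤ n → t (i + 1) ≤ t k := by
    intro k h1 h2
    rcases Nat.eq_or_lt_of_le (show i + 1 ≤ k from h1) with rfl | hlt
    · exact le_rfl
    · exact (h.tm _ _ hlt h2).le
  have ble : ∀ k, i < k → k ≤ n → b k ≤ b (i + 1) := by
    intro k h1 h2
    rcases Nat.eq_or_lt_of_le (show i + 1 ≤ k from h1) with rfl | hlt
    · exact le_rfl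
    · exact (h.bm _ _ hlt h2).le
  have all : ∀ v v' : ℕ, (∀ k, k ≤ n → hh (t' k) (b' k) v' = hh (t k) (b k) v) →
      sv n t' b' v' = sv n t b v := by
    intro v v' hk
    ext j
    have := j.2
    simp only [sv]
    rw [hk _ (by omega), hk _ (by omega)]
  refine ⟨?_, ?_, ?_⟩
  · intro v hv
    apply all
    intro k hk
    rcases Nat.lt_or_ge i k with h1 | h1
    · have a1 := tge k h1 hk
      have a2 := h.le k hk
      rw [(q2 k h1 hk).1, (q2 k h1 hk).2]
      unfold hh
      rw [min_eq_left (by omega), min_eq_left (by omega), min_eq_left (by omega),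
        min_eq_left (by omega)]
    · exact lo k v h1
  · intro v hv1 hv2
    have hi1 : ∀ k, i < k → k ≤ n → hh (t' k) (b' k) (v + 1) = hh (t k) (b k) v := by
      intro k h1 hk
      rw [(q2 k h1 hk).1, (q2 k h1 hk).2]
      unfold hh
      rw [Nat.add_min_add_right, Nat.add_min_add_right]
      push_cast; ring
    have lo1 : ∀ k, k ≤ i → hh (t' k) (b' k) (v + 1) = hh (t k) (b k) v + 1 := by
      intro k hk
      rw [lo k _ hk, hh_succ (h.le k (by omega))]
      unfold zt
      have a1 := h.tm k (i + 1) (by omega) (by omega)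
      have a2 := h.bm k (i + 1) (by omega) (by omega)
      rw [if_pos (by omega)]
    ext j
    have hj := j.2
    simp only [sv, Pi.add_apply, Pi.single_apply, Fin.ext_iff]
    rcases lt_trichotomy (j : ℕ) i with hlt | heq | hlt
    · rw [lo1 _ (by omega), lo1 _ (by omega), if_neg (by omega)]; ring
    · rw [lo1 _ (by omega), hi1 _ (by omega) (by omega), if_pos heq]; ring
    · rw [hi1 _ (by omega) (by omega), hi1 _ (by omega) (by omega), if_neg (by omega)]; ring
  · intro v hv
    apply all
    intro k hk
    rcases Nat.lt_or_ge i k with h1 | h1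
    · have a1 := ble k h1 hk
      have a2 := h.le k hk
      rw [(q2 k h1 hk).1, (q2 k h1 hk).2]
      unfold hh
      rw [min_eq_right (by omega), min_eq_right (by omega), min_eq_right (by omega),
        min_eq_right (by omega)]
      push_cast; ring
    · exact lo k v h1

theorem concave {n : ℕ} {t b t1 b1 t2 b2 : ℕ → ℕ} (h : Ch n t b) (h1 : Ch n t1 b1) (h2 : Ch n t2 b2)
    (i : ℕ) (hi0 : 1 ≤ i) (hi : i + 1 < n) (p1 : ∀ k, k ≤ i → t1 k = t k ∧ b1 k = b k)
    (p2 : ∀ k, i < k → k ≤ n → t1 k = t k + 1 ∧ b1 k = b k + 1)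
    (q1 : ∀ k, k ≤ i → t2 k = t1 k ∧ b2 k = b1 k)
    (q2 : ∀ k, i < k → k ≤ n → t2 k = t1 k + 1 ∧ b2 k = b1 k + 1) :
    kirchhoff (octG n t2 b2) + kirchhoff (octG n t b) < 2 * kirchhoff (octG n t1 b1) := by
  rw [kirchhoff_eq h, kirchhoff_eq h1, kirchhoff_eq h2]
  obtain ⟨s1, s2, s3⟩ := sv_shift h h1 i hi p1 p2
  obtain ⟨r1, r2, r3⟩ := sv_shift h1 h2 i hi q1 q2
  have e1 := p2 (i + 1) (by omega) (by omega)
  have e2 := q2 (i + 1) (by omega) (by omega)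
  rw [e1.1] at r1 r2
  rw [e1.2] at r2 r3
  have hle := h.le (i + 1) (by omega)
  have hlen := h.len (i + 1) (by omega) hi
  have hb2 := h2.bm 0 (i + 1) (by omega) (by omega)
  rw [h2.b0] at hb2
  have D := second_diff (BB n) BB_symm (6 * n + 2) (t (i + 1)) (b (i + 1)) (sv n t b) (sv n t1 b1)
    (sv n t2 b2) (Pi.single ⟨i, by omega⟩ 1) hle (by omega) s1 s2 s3 r1 r2 r3
  have W : ∀ j : Fin n, (sv n t b (b (i + 1)) - sv n t b (t (i + 1))) j = cnt n (i + 1) j := by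
    intro j
    rw [← cnt_eq h j (i + 1) j.2 hi]
    simp only [sv, Pi.sub_apply]
    ring
  have hbR : ((b (i + 1) - t (i + 1) : ℕ) : ℝ) = 6 * (n - (i + 1)) + 1 := by
    rw [hlen, show t (i + 1) + 6 * (n - (i + 1)) + 1 - t (i + 1) = 6 * (n - (i + 1)) + 1 by omega]
    push_cast [Nat.cast_sub hi.le]
    ring
  have hiR : (i : ℝ) + 2 ≤ n := by exact_mod_cast hi
  have hi0R : (1 : ℝ) ≤ i := by exact_mod_cast hi0
  have K := key_ineq (⟨i, by omega⟩ : Fin n) (sv n t b (b (i + 1)) - sv n t b (t (i + 1)))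
    ((b (i + 1) - t (i + 1) : ℕ) : ℝ) (6 * i + 7) (by rw [hbR]; linarith) (by linarith)
    (by intro j; rw [W]; unfold cnt; split_ifs <;> norm_num)
    (by rw [W]; unfold cnt; rw [if_pos]; simp)
    (by
      have hs : ∀ v, ∑ j, sv n t b v j = hh (t 0) (b 0) v := by
        intro v
        unfold sv
        rw [Fin.sum_univ_eq_sum_range (fun j => hh (t j) (b j) v - hh (t (j + 1)) (b (j + 1)) v),
          Finset.sum_range_sub', h.bn]
        simp [hh]
      simp only [Pi.sub_apply, Finset.sum_sub_distrib, hs]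
      rw [hh_in h 0 (i + 1) (by omega) (by omega), if_pos (by omega), Nat.cast_sub hle])
    (by intro j; rw [W]; unfold cnt; split_ifs <;> norm_num)
  have hN : ((6 * n + 2 : ℕ) : ℝ) = ((b (i + 1) - t (i + 1) : ℕ) : ℝ) + (6 * i + 7) := by
    rw [hbR]; push_cast; ring
  rw [← hN] at K
  linarith

/-- bottom positions, completed at the ends -/
def bp (n : ℕ) (w : Fin (n - 2) → Fin 5) (k : ℕ) : ℕ :=
  if k = 0 then 6 * n + 2 else if k < n then bpos n w k else tpos n w k

theorem octChain_eq (n : ℕ) (w : Fin (n - 2) → Fin 5) :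
    octChain n w = octG n (tpos n w) (bp n w) := by
  unfold octChain octG
  congr 1
  funext x y
  congr 2
  apply propext
  apply exists_congr
  intro k
  constructor
  · rintro ⟨a1, a2, a3, a4⟩
    exact ⟨a1, a2, a3, by rw [a4, bp, if_neg (by omega), if_pos (by omega)]⟩
  · rintro ⟨a1, a2, a3, a4⟩
    exact ⟨a1, a2, a3, by rw [a4, bp, if_neg (by omega), if_pos (by omega)]⟩

theorem tpos_lt (n : ℕ) (w : Fin (n - 2) → Fin 5) (j k : ℕ) (h : j < k) : tpos n w j < tpos n w k := by
  unfold tpos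
  apply Nat.add_lt_add_of_lt_of_le h
  apply Finset.sum_le_sum_of_subset
  intro a ha
  simp at ha ⊢
  omega

theorem bpos_len (n : ℕ) (hn : 3 ≤ n) (w : Fin (n - 2) → Fin 5) (k : ℕ) (h1 : 1 ≤ k) (hk : k < n) :
    bpos n w k = tpos n w k + 6 * (n - k) + 1 := by
  unfold bpos tpos
  have e1 : ∑ j, (w j : ℕ) = ∑ j ∈ univ.filter (fun j : Fin (n - 2) => (j : ℕ) + 1 < k), (w j : ℕ) +
      ∑ j ∈ univ.filter (fun j : Fin (n - 2) => k ≤ (j : ℕ) + 1), (w j : ℕ) := by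
    rw [← Finset.sum_filter_add_sum_filter_not univ (fun j : Fin (n - 2) => (j : ℕ) + 1 < k)]
    simp only [not_lt]
  have e2 : ∑ j ∈ univ.filter (fun j : Fin (n - 2) => k ≤ (j : ℕ) + 1), (w j : ℕ) +
      ∑ j ∈ univ.filter (fun j : Fin (n - 2) => k ≤ (j : ℕ) + 1), (5 - (w j : ℕ)) = 5 * (n - 1 - k) := by
    rw [← Finset.sum_add_distrib]
    have : ∀ j ∈ univ.filter (fun j : Fin (n - 2) => k ≤ (j : ℕ) + 1), (w j : ℕ) + (5 - (w j : ℕ)) = 5 := by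
      intro j _; have := (w j).2; omega
    rw [Finset.sum_congr rfl this, Finset.sum_filter,
      Fin.sum_univ_eq_sum_range (fun j => if k ≤ j + 1 then 5 else 0), ← Finset.sum_filter]
    have : (range (n - 2)).filter (fun j => k ≤ j + 1) = Ico (k - 1) (n - 2) := by
      ext a; simp; omega
    rw [this]
    simp
    omega
  omega

theorem bpos_lt (n : ℕ) (w : Fin (n - 2) → Fin 5) (j k : ℕ) (h1 : 1 ≤ j) (h : j < k) (hk : k < n) :
    bpos n w k < bpos n w j := by
  unfold bpos
  apply Nat.add_lt_add_left
  refine Finset.sum_lt_sum_of_subset (i := ⟨j - 1, by omega⟩) ?_ ?_ ?_ ?_ ?_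
  · intro a ha
    simp at ha ⊢
    omega
  · rw [Finset.mem_filter]
    refine ⟨Finset.mem_univ _, ?_⟩
    show j ≤ j - 1 + 1
    omega
  · rw [Finset.mem_filter]
    rintro ⟨_, h3⟩
    have h4 : k ≤ j - 1 + 1 := h3
    omega
  · have := (w ⟨j - 1, by omega⟩).2; omega
  · intros; exact Nat.zero_le _

theorem ch (n : ℕ) (hn : 3 ≤ n) (w : Fin (n - 2) → Fin 5) : Ch n (tpos n w) (bp n w) := by
  have t5 : ∀ k, tpos n w k ≤ k + ∑ j, (w j : ℕ) := by
    intro k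
    unfold tpos
    apply Nat.add_le_add_left
    exact Finset.sum_le_sum_of_subset (Finset.filter_subset _ _)
  have t1 : tpos n w 1 = 1 := by
    unfold tpos; simp
  have b1 : ∀ k, 1 ≤ k → k < n → bpos n w k < 6 * n + 2 := by
    intro k k1 k2
    have e := bpos_len n hn w 1 le_rfl (by omega)
    rw [t1] at e
    rcases Nat.eq_or_lt_of_le k1 with rfl | hlt
    · omega
    · have := bpos_lt n w 1 k le_rfl hlt k2
      omega
  have bt : ∀ k, 1 ≤ k → k < n → tpos n w n < bpos n w k := by
    intro k k1 k2
    have := t5 n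
    unfold bpos
    omega
  refine ⟨hn, ?_, ?_, ?_, ?_, ?_, ?_⟩
  · unfold tpos; simp
  · simp [bp]
  · unfold bp; rw [if_neg (by omega), if_neg (by omega)]
  · intro j k hjk _; exact tpos_lt n w j k hjk
  · intro j k hjk hk
    unfold bp
    rw [if_neg (show ¬ k = 0 by omega)]
    by_cases hkn : k < n
    · rw [if_pos hkn]
      by_cases hj : j = 0
      · rw [if_pos hj]; exact b1 k (by omega) hkn
      · rw [if_neg hj, if_pos (by omega)]; exact bpos_lt n w j k (by omega) hjk hkn
    · have : k = n := by omega
      subst this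
      rw [if_neg hkn]
      by_cases hj : j = 0
      · rw [if_pos hj]
        have a1 := b1 1 le_rfl (by omega)
        have a2 := bt 1 le_rfl (by omega)
        omega
      · rw [if_neg hj, if_pos (by omega)]; exact bt j (by omega) hjk
  · intro k k1 k2
    unfold bp
    rw [if_neg (by omega), if_pos k2, bpos_len n hn w k k1 k2]

theorem w_shift (n : ℕ) (hn : 3 ≤ n) (w w' : Fin (n - 2) → Fin 5) (i : Fin (n - 2))
    (hw : ∀ j, (w' j : ℕ) = w j + if j = i then 1 else 0) :
    (∀ k, k ≤ (i : ℕ) + 1 → tpos n w' k = tpos n w k ∧ bp n w' k = bp n w k) ∧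
    (∀ k, (i : ℕ) + 1 < k → k ≤ n → tpos n w' k = tpos n w k + 1 ∧ bp n w' k = bp n w k + 1) := by
  have hi := i.2
  have ht : ∀ k, tpos n w' k = tpos n w k + if (i : ℕ) + 1 < k then 1 else 0 := by
    intro k
    unfold tpos
    simp only [hw, Finset.sum_add_distrib, Finset.sum_ite_eq', Finset.mem_filter, Finset.mem_univ,
      true_and]
    omega
  constructor
  · intro k hk
    have e := ht k
    rw [if_neg (by omega)] at e
    refine ⟨by omega, ?_⟩
    unfold bp
    by_cases h0 : k = 0
    · rw [if_pos h0, if_pos h0]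
    · rw [if_neg h0, if_neg h0, if_pos (by omega), if_pos (by omega),
        bpos_len n hn w' k (by omega) (by omega), bpos_len n hn w k (by omega) (by omega)]
      omega
  · intro k hk hkn
    have e := ht k
    rw [if_pos (by omega)] at e
    refine ⟨by omega, ?_⟩
    unfold bp
    have k0 : ¬ k = 0 := by omega
    rw [if_neg k0, if_neg k0]
    by_cases h1 : k < n
    · rw [if_pos h1, if_pos h1,
        bpos_len n hn w' k (by omega) (by omega), bpos_len n hn w k (by omega) (by omega)]
      omega
    · rw [if_neg h1, if_neg h1]; omega

end OctAux

/-- Every octagonal chain with minimum Kirchhoff index among all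
octagonal chains with `n ≥ 3` octagons is an all-kink chain: each `w_i ∈ {0, 4}`. -/
theorem min_kirchhoff_is_all_kink (n : ℕ) (hn : 3 ≤ n) (w : Fin (n - 2) → Fin 5)
    (hmin : ∀ w'' : Fin (n - 2) → Fin 5,
      kirchhoff (octChain n w) ≤ kirchhoff (octChain n w'')) :
    ∀ i : Fin (n - 2), w i = 0 ∨ w i = 4 := by
  intro i
  by_contra hcon
  push Not at hcon
  have hi := i.2
  have hw := (w i).2
  have h0 : (w i : ℕ) ≠ 0 := fun h => hcon.1 (Fin.ext h)
  have h4 : (w i : ℕ) ≠ 4 := fun h => hcon.2 (Fin.ext h)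
  let wm : Fin (n - 2) → Fin 5 := Function.update w i ⟨(w i : ℕ) - 1, by omega⟩
  let wp : Fin (n - 2) → Fin 5 := Function.update w i ⟨(w i : ℕ) + 1, by omega⟩
  have m := OctAux.w_shift n hn wm w i (by
    intro j
    by_cases hj : j = i
    · subst hj; simp [wm]; omega
    · simp [wm, hj])
  have p := OctAux.w_shift n hn w wp i (by
    intro j
    by_cases hj : j = i
    · subst hj; simp [wp]
    · simp [wp, hj])
  have key := OctAux.concave (OctAux.ch n hn wm) (OctAux.ch n hn w) (OctAux.ch n hn wp) ((i : ℕ) + 1)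
    (by omega) (by omega) m.1 m.2 p.1 p.2
  rw [← OctAux.octChain_eq, ← OctAux.octChain_eq, ← OctAux.octChain_eq] at key
  linarith [hmin wm, hmin wp]
end
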